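/- Let α : [0,1] → ℝ be measurable with α(t) > 0 for all t and with 1/α integrable on [0,1], and let ψ(x) = (∫₀¹ α(t)⁻¹ dt)⁻¹ · ∫₀ˣ α(t)⁻¹ dt. Then the weighted energy of ψ satisfies ∫₀¹ α(t) (ψ′(t))² dt = (∫₀¹ α(t)⁻¹ dt)⁻¹, and for every Lipschitz function v : [0,1] → ℝ with v(0) = 0 and v(1) = 1 such that t ↦ α(t)(v′(t))² is integrable, one has ∫₀¹ α(t) (ψ′(t))² dt ≤ ∫₀¹ α(t) (v′(t))² dt. That is, the oscillatory boundary function minimizes the weighted energy among all Lipschitz functions with the same boundary values. -/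

import Mathlib

open MeasureTheory

/-- For a measurable, positive coefficient `α` on `[0,1]` with integrable reciprocal,
the oscillatory boundary function `ψ(x) = (∫₀¹ α⁻¹)⁻¹ · ∫₀ˣ α⁻¹` has weighted energy
`∫₀¹ α (ψ′)² = (∫₀¹ α⁻¹)⁻¹`, and it minimizes the weighted energy among all Lipschitz
functions `v` with `v(0) = 0`, `v(1) = 1` whose weighted energy density is integrable. -/
theorem oscillatory_boundary_energy_minimizing (α : ℝ → ℝ) (hmeas : Measurable α)
    (hpos : ∀ t ∈ Set.Icc (0 : ℝ) 1, 0 < α t)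
    (hint : IntervalIntegrable (fun t => (α t)⁻¹) volume 0 1)
    (ψ : ℝ → ℝ)
    (hψ : ∀ x, ψ x = (∫ t in (0 : ℝ)..1, (α t)⁻¹)⁻¹ * ∫ t in (0 : ℝ)..x, (α t)⁻¹) :
    (∫ t in (0 : ℝ)..1, α t * (deriv ψ t) ^ 2 = (∫ t in (0 : ℝ)..1, (α t)⁻¹)⁻¹) ∧
      ∀ (v : ℝ → ℝ) (K : NNReal), LipschitzWith K v → v 0 = 0 → v 1 = 1 →
        IntervalIntegrable (fun t => α t * (deriv v t) ^ 2) volume 0 1 →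
        ∫ t in (0 : ℝ)..1, α t * (deriv ψ t) ^ 2 ≤ ∫ t in (0 : ℝ)..1, α t * (deriv v t) ^ 2 := by
  set A := ∫ t in (0 : ℝ)..1, (α t)⁻¹ with hA
  have hA_pos : 0 < A :=
    intervalIntegral.intervalIntegral_pos_of_pos_on hint
      (fun t ht => inv_pos.2 (hpos t (Set.Ioo_subset_Icc_self ht))) one_pos
  have hψ_deriv : ∀ᵐ t, t ∈ Set.uIoc (0 : ℝ) 1 → deriv ψ t = A⁻¹ * (α t)⁻¹ := by
    filter_upwards [hint.ae_hasDerivAt_integral] with t ht hmem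
    rw [funext hψ]
    exact ((ht (Set.uIoc_subset_uIcc hmem) 0 Set.left_mem_uIcc).const_mul A⁻¹).deriv
  have h_energy : ∫ t in (0 : ℝ)..1, α t * (deriv ψ t) ^ 2 = A⁻¹ := by
    calc ∫ t in (0 : ℝ)..1, α t * (deriv ψ t) ^ 2
        = ∫ t in (0 : ℝ)..1, A⁻¹ ^ 2 * (α t)⁻¹ := by
          refine intervalIntegral.integral_congr_ae ?_
          filter_upwards [hψ_deriv] with t ht hmem
          rw [Set.uIoc_of_le zero_le_one] at hmem ht
          have := (hpos t (Set.Ioc_subset_Icc_self hmem)).ne'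
          rw [ht hmem]
          field_simp
      _ = A⁻¹ := by
          rw [intervalIntegral.integral_const_mul, ← hA]
          field_simp
  refine ⟨h_energy, fun v K hv hv0 hv1 hv_int => ?_⟩
  have hv_ac : AbsolutelyContinuousOnInterval v 0 1 :=
    hv.lipschitzOnWith.absolutelyContinuousOnInterval
  have h_lin := hv_ac.intervalIntegrable_deriv.const_mul (2 * A⁻¹)
  have h_inv := hint.const_mul (A⁻¹ ^ 2)
  calc ∫ t in (0 : ℝ)..1, α t * (deriv ψ t) ^ 2
      = ∫ t in (0 : ℝ)..1, (2 * A⁻¹ * deriv v t - A⁻¹ ^ 2 * (α t)⁻¹) := by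
        rw [h_energy, intervalIntegral.integral_sub h_lin h_inv,
          intervalIntegral.integral_const_mul, intervalIntegral.integral_const_mul,
          hv_ac.integral_deriv_eq_sub, hv0, hv1, ← hA]
        field_simp
        norm_num
    _ ≤ ∫ t in (0 : ℝ)..1, α t * (deriv v t) ^ 2 := by
        refine intervalIntegral.integral_mono_on zero_le_one (h_lin.sub h_inv) hv_int
          fun t ht => ?_
        have hα := hpos t ht
        have h_square : α t * (deriv v t) ^ 2 - (2 * A⁻¹ * deriv v t - A⁻¹ ^ 2 * (α t)⁻¹) =
            (α t * deriv v t - A⁻¹) ^ 2 * (α t)⁻¹ := by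
          field_simp
          ring
        have h_nonneg : 0 ≤ (α t * deriv v t - A⁻¹) ^ 2 * (α t)⁻¹ := by positivity
        linarith
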